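/- Theorem 1, converse part for the regime P ≤ (K−M)/2. Under the PIR-with-private-side-information setup, with S = {1,…,M} and demand set 𝒫 = {M+1,…,M+P}, if P ≤ (K−M)/2 then, writing t = ⌊(K−M)/P⌋, the normalized total download satisfies (1/(P·L))·∑_{n=1}^{N} H(A_n^{S,𝒫}) ≥ (1 − (1/N)^t)/(1 − 1/N) + ((K−M)/P − t)/N^t. In particular, if P divides K−M this bound equals (1 − (1/N)^{(K−M)/P})/(1 − 1/N) = ∑_{j=0}^{(K−M)/P − 1} (1/N)^j. -/

import Mathlib

open scoped BigOperators

/-- Probability that random variable `X` takes the value `x`, under the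
probability mass function `p` on the finite sample space `Ω`. -/
noncomputable def pr {Ω : Type} [Fintype Ω] (p : Ω → ℝ) {α : Type} [DecidableEq α]
    (X : Ω → α) (x : α) : ℝ :=
  ∑ ω ∈ Finset.univ.filter (fun ω => X ω = x), p ω

/-- Shannon entropy of `X` in base `b` (with the convention `0 * log 0 = 0`). -/
noncomputable def ent {Ω : Type} [Fintype Ω] (b : ℝ) (p : Ω → ℝ) {α : Type} [Fintype α]
    [DecidableEq α] (X : Ω → α) : ℝ :=
  -∑ x : α, pr p X x * Real.logb b (pr p X x)

/-- Conditional entropy `H(X ∣ Y) = H(X, Y) - H(Y)`, in base `b`. -/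
noncomputable def condEnt {Ω : Type} [Fintype Ω] (b : ℝ) (p : Ω → ℝ) {α β : Type} [Fintype α]
    [DecidableEq α] [Fintype β] [DecidableEq β] (X : Ω → α) (Y : Ω → β) : ℝ :=
  ent b p (fun ω => (X ω, Y ω)) - ent b p Y

/-- `X` is a deterministic function of `Y`. -/
def detFn {Ω α β : Type} (X : Ω → α) (Y : Ω → β) : Prop :=
  ∃ f : β → α, ∀ ω, X ω = f (Y ω)

/-- Admissible demand sets: subsets of `{1,…,K} \ S` of size `P`
(indices are `0`-based, and `S = {1,…,M}` corresponds to indices `< M`). -/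
def demands (K M P : ℕ) : Finset (Finset (Fin K)) :=
  Finset.univ.filter (fun T => T.card = P ∧ ∀ i ∈ T, M ≤ i.val)

theorem pr_nonneg {Ω α : Type} [Fintype Ω] [DecidableEq α] {p : Ω → ℝ}
    (hp0 : ∀ ω, 0 ≤ p ω) (X : Ω → α) (x : α) : 0 ≤ pr p X x :=
  Finset.sum_nonneg fun ω _ => hp0 ω

theorem le_pr_apply {Ω α : Type} [Fintype Ω] [DecidableEq α] {p : Ω → ℝ}
    (hp0 : ∀ ω, 0 ≤ p ω) (X : Ω → α) (ω : Ω) : p ω ≤ pr p X (X ω) :=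
  Finset.single_le_sum (f := p) (fun i _ => hp0 i) (by simp)

section Entropy

variable {Ω α β γ : Type} [Fintype Ω] [Fintype α] [DecidableEq α] [Fintype β] [DecidableEq β]
  [Fintype γ] [DecidableEq γ] {p : Ω → ℝ} {b : ℝ}

theorem sum_mul_comp_eq_sum_pr (X : Ω → α) (g : α → ℝ) :
    ∑ ω, p ω * g (X ω) = ∑ x, pr p X x * g x := by
  rw [← Finset.sum_fiberwise Finset.univ X]
  refine Finset.sum_congr rfl fun x _ => ?_
  rw [pr, Finset.sum_mul]
  refine Finset.sum_congr rfl fun ω hω => ?_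
  rw [(Finset.mem_filter.1 hω).2]

theorem ent_eq_neg_sum (b : ℝ) (p : Ω → ℝ) (X : Ω → α) :
    ent b p X = -∑ ω, p ω * Real.logb b (pr p X (X ω)) := by
  rw [ent, sum_mul_comp_eq_sum_pr X (fun x => Real.logb b (pr p X x))]

theorem sum_pr_eq_sum (X : Ω → α) : ∑ x, pr p X x = ∑ ω, p ω := by
  simpa using (sum_mul_comp_eq_sum_pr (p := p) X (fun _ => 1)).symm

theorem sum_pr_prod_left {δ : Type} [DecidableEq δ] (X : Ω → α) (Y : Ω → δ) (y : δ) :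
    ∑ x, pr p (fun ω => (X ω, Y ω)) (x, y) = pr p Y y := by
  rw [pr, ← Finset.sum_fiberwise (Finset.univ.filter fun ω => Y ω = y) X]
  refine Finset.sum_congr rfl fun x _ => ?_
  rw [pr, Finset.filter_filter]
  refine Finset.sum_congr ?_ fun _ _ => rfl
  ext ω
  simp [and_comm]

/-- A deterministic function of `Y` has at most the entropy of `Y`. -/
theorem ent_le_of_detFn (hb : 1 < b) (hp0 : ∀ ω, 0 ≤ p ω) {X : Ω → α} {Y : Ω → β}
    (h : detFn X Y) : ent b p X ≤ ent b p Y := by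
  obtain ⟨f, hf⟩ := h
  rw [ent_eq_neg_sum, ent_eq_neg_sum]
  refine neg_le_neg (Finset.sum_le_sum fun ω _ => ?_)
  rcases (hp0 ω).eq_or_lt with h0 | h0
  · simp [← h0]
  refine mul_le_mul_of_nonneg_left (Real.logb_le_logb_of_le hb
    (h0.trans_le (le_pr_apply hp0 Y ω)) ?_) h0.le
  refine Finset.sum_le_sum_of_subset_of_nonneg (fun ω' hω' => ?_) fun i _ _ => hp0 i
  simp only [Finset.mem_filter, Finset.mem_univ, true_and] at hω' ⊢
  rw [hf, hf, hω']

theorem sum_pr_mul_pr_div_le (hp0 : ∀ ω, 0 ≤ p ω)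
    (X : Ω → α) (Y : Ω → β) (Z : Ω → γ) :
    ∑ ω, p ω * (pr p (fun ω => (X ω, Z ω)) (X ω, Z ω) * pr p (fun ω => (Y ω, Z ω)) (Y ω, Z ω)
      / (pr p (fun ω => (X ω, Y ω, Z ω)) (X ω, Y ω, Z ω) * pr p Z (Z ω))) ≤ ∑ ω, p ω := by
  rw [sum_mul_comp_eq_sum_pr (fun ω => (X ω, Y ω, Z ω)) (fun t : α × β × γ =>
    pr p (fun ω => (X ω, Z ω)) (t.1, t.2.2) * pr p (fun ω => (Y ω, Z ω)) (t.2.1, t.2.2)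
      / (pr p (fun ω => (X ω, Y ω, Z ω)) t * pr p Z t.2.2))]
  calc _ ≤ ∑ t : α × β × γ, pr p (fun ω => (X ω, Z ω)) (t.1, t.2.2)
          * pr p (fun ω => (Y ω, Z ω)) (t.2.1, t.2.2) / pr p Z t.2.2 := by
        refine Finset.sum_le_sum fun t _ => ?_
        rcases (pr_nonneg hp0 (fun ω => (X ω, Y ω, Z ω)) t).eq_or_lt with h0 | h0
        · rw [← h0, zero_mul]
          exact div_nonneg (mul_nonneg (pr_nonneg hp0 _ _) (pr_nonneg hp0 _ _)) (pr_nonneg hp0 _ _)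
        · rw [mul_div_assoc', mul_div_mul_left _ _ h0.ne']
    _ = ∑ z, pr p Z z * pr p Z z / pr p Z z := by
        simp_rw [Fintype.sum_prod_type]
        conv_lhs => enter [2, x]; rw [Finset.sum_comm]
        rw [Finset.sum_comm]
        refine Finset.sum_congr rfl fun z _ => ?_
        simp_rw [← Finset.sum_div, ← Finset.mul_sum, ← Finset.sum_mul, sum_pr_prod_left]
    _ = ∑ ω, p ω := by
        rw [← sum_pr_eq_sum Z]
        exact Finset.sum_congr rfl fun z _ => mul_self_div_self _

/-- Submodularity of Shannon entropy. -/
theorem ent_submodular (hb : 1 < b) (hp0 : ∀ ω, 0 ≤ p ω)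
    (X : Ω → α) (Y : Ω → β) (Z : Ω → γ) :
    ent b p (fun ω => (X ω, Y ω, Z ω)) + ent b p Z
      ≤ ent b p (fun ω => (X ω, Z ω)) + ent b p (fun ω => (Y ω, Z ω)) := by
  have hlog : 0 < Real.log b := Real.log_pos hb
  have key := sum_pr_mul_pr_div_le hp0 X Y Z
  simp only [ent_eq_neg_sum]
  set a : Ω → ℝ := fun ω => pr p (fun ω => (X ω, Z ω)) (X ω, Z ω) with ha
  set c : Ω → ℝ := fun ω => pr p (fun ω => (Y ω, Z ω)) (Y ω, Z ω) with hc
  set d : Ω → ℝ := fun ω => pr p (fun ω => (X ω, Y ω, Z ω)) (X ω, Y ω, Z ω) with hd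
  set e : Ω → ℝ := fun ω => pr p Z (Z ω) with he
  have main : ∑ ω, (p ω * Real.logb b (a ω) + p ω * Real.logb b (c ω)
      - p ω * Real.logb b (d ω) - p ω * Real.logb b (e ω))
      ≤ ∑ ω, (p ω * (a ω * c ω / (d ω * e ω)) - p ω) / Real.log b := by
    refine Finset.sum_le_sum fun ω _ => ?_
    rcases (hp0 ω).eq_or_lt with h0 | h0
    · simp [← h0]
    have h1 : 0 < a ω := h0.trans_le (le_pr_apply hp0 (fun ω => (X ω, Z ω)) ω)
    have h2 : 0 < c ω := h0.trans_le (le_pr_apply hp0 (fun ω => (Y ω, Z ω)) ω)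
    have h3 : 0 < d ω := h0.trans_le (le_pr_apply hp0 (fun ω => (X ω, Y ω, Z ω)) ω)
    have h4 : 0 < e ω := h0.trans_le (le_pr_apply hp0 Z ω)
    have h5 := Real.log_le_sub_one_of_pos (div_pos (mul_pos h1 h2) (mul_pos h3 h4))
    rw [Real.log_div (by positivity) (by positivity), Real.log_mul h1.ne' h2.ne',
      Real.log_mul h3.ne' h4.ne'] at h5
    rw [le_div_iff₀ hlog]
    simp only [Real.logb]
    have h6 : (p ω * (Real.log (a ω) / Real.log b) + p ω * (Real.log (c ω) / Real.log b)
        - p ω * (Real.log (d ω) / Real.log b) - p ω * (Real.log (e ω) / Real.log b)) * Real.log b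
        = p ω * (Real.log (a ω) + Real.log (c ω) - (Real.log (d ω) + Real.log (e ω))) := by
      field_simp
      ring
    rw [h6]
    nlinarith [mul_le_mul_of_nonneg_left h5 h0.le]
  rw [← Finset.sum_div] at main
  have hnonpos : ∑ ω, (p ω * (a ω * c ω / (d ω * e ω)) - p ω) ≤ 0 := by
    rw [Finset.sum_sub_distrib]
    exact sub_nonpos.2 key
  have h7 := main.trans (div_nonpos_of_nonpos_of_nonneg hnonpos hlog.le)
  simp only [Finset.sum_sub_distrib, Finset.sum_add_distrib] at h7
  linarith

theorem ent_const (hp1 : ∑ ω, p ω = 1) (x : α) : ent b p (fun _ => x) = 0 := by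
  simp [ent_eq_neg_sum, pr, hp1]

/-- Conditioning does not increase entropy. -/
theorem condEnt_le_ent (hb : 1 < b) (hp0 : ∀ ω, 0 ≤ p ω) (hp1 : ∑ ω, p ω = 1)
    (X : Ω → α) (Y : Ω → β) : condEnt b p X Y ≤ ent b p X := by
  have h := ent_submodular hb hp0 X Y (fun _ => ())
  have h1 : ent b p (fun ω => (X ω, Y ω)) ≤ ent b p (fun ω => (X ω, Y ω, ())) :=
    ent_le_of_detFn hb hp0 ⟨fun t => (t.1, t.2.1), fun _ => rfl⟩
  have h2 : ent b p (fun ω => (X ω, ())) ≤ ent b p X :=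
    ent_le_of_detFn hb hp0 ⟨fun t => (t, ()), fun _ => rfl⟩
  have h3 : ent b p (fun ω => (Y ω, ())) ≤ ent b p Y :=
    ent_le_of_detFn hb hp0 ⟨fun t => (t, ()), fun _ => rfl⟩
  rw [ent_const hp1] at h
  rw [condEnt]
  linarith

/-- Conditional subadditivity of Shannon entropy over a finite family. -/
theorem condEnt_finset_le_sum {ι : Type} [DecidableEq ι] (hb : 1 < b)
    (hp0 : ∀ ω, 0 ≤ p ω) (X : ι → Ω → α) (Z : Ω → γ) (s : Finset ι) :
    condEnt b p (fun ω (i : ↥s) => X i ω) Z ≤ ∑ i ∈ s, condEnt b p (X i) Z := by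
  induction s using Finset.induction_on with
  | empty =>
    have h : ent b p (fun ω => ((fun i : ↥(∅ : Finset ι) => X i ω), Z ω)) ≤ ent b p Z :=
      ent_le_of_detFn hb hp0 ⟨fun z => (fun i => absurd i.2 (Finset.notMem_empty _), z),
        fun ω => Prod.ext (funext fun i => absurd i.2 (Finset.notMem_empty _)) rfl⟩
    simpa [condEnt] using h
  | insert a s ha ih =>
    rw [Finset.sum_insert ha]
    have h1 := ent_submodular hb hp0 (X a) (fun ω (i : ↥s) => X i ω) Z
    have h2 : ent b p (fun ω => ((fun i : ↥(insert a s) => X i ω), Z ω))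
        ≤ ent b p (fun ω => (X a ω, (fun i : ↥s => X i ω), Z ω)) := by
      refine ent_le_of_detFn hb hp0 ⟨fun t => (fun i => if h : i.1 ∈ s then t.2.1 ⟨i.1, h⟩ else t.1,
        t.2.2), fun ω => Prod.ext (funext fun i => ?_) rfl⟩
      by_cases h : i.1 ∈ s
      · simp [h]
      · have hi : i.1 = a := (Finset.mem_insert.1 i.2).resolve_right h
        simp [ha, hi]
    simp only [condEnt] at ih ⊢
    linarith

/-- If `Y'` is determined by the family `X` together with `Y`, then the entropies of the `X i`
given `Y` account for the gain from `Y` to `Y'` and for what is left of any single `X i₀`. -/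
theorem ent_sub_add_condEnt_le_sum {ι : Type} [Fintype ι] [DecidableEq ι] (hb : 1 < b)
    (hp0 : ∀ ω, 0 ≤ p ω) (X : ι → Ω → α) (Y : Ω → β) (Y' : Ω → γ) (i₀ : ι)
    (h : detFn Y' (fun ω => ((fun i => X i ω), Y ω))) :
    ent b p Y' - ent b p Y + condEnt b p (X i₀) Y' ≤ ∑ i, condEnt b p (X i) Y := by
  obtain ⟨f, hf⟩ := h
  have h1 := condEnt_finset_le_sum hb hp0 X Y Finset.univ
  have h2 : ent b p (fun ω => (X i₀ ω, Y' ω))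
      ≤ ent b p (fun ω => ((fun i : ↥(Finset.univ : Finset ι) => X i ω), Y ω)) :=
    ent_le_of_detFn hb hp0 ⟨fun t => (t.1 ⟨i₀, Finset.mem_univ _⟩,
      f (fun i => t.1 ⟨i, Finset.mem_univ _⟩, t.2)), fun ω => Prod.ext rfl (hf ω)⟩
  simp only [condEnt] at h1 ⊢
  linarith

theorem condEnt_nonneg (hb : 1 < b) (hp0 : ∀ ω, 0 ≤ p ω) (X : Ω → α) (Y : Ω → β) :
    0 ≤ condEnt b p X Y :=
  sub_nonneg.2 (ent_le_of_detFn hb hp0 ⟨Prod.snd, fun _ => rfl⟩)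

end Entropy

section Library

variable {Ω F Θ : Type} [Fintype Ω] [Fintype F] [DecidableEq F] [DecidableEq Θ]
  {p : Ω → ℝ} {K L : ℕ}

theorem card_filter_restrict_eq (G : Type) [Fintype G] [DecidableEq G] (T : Finset (Fin K))
    (v : ↥T → G) :
    ((Finset.univ : Finset (Fin K → G)).filter (fun w => (fun i : ↥T => w i) = v)).card
      = Fintype.card G ^ (K - T.card) := by
  have h : (Finset.univ : Finset (Fin K → G)).filter (fun w => (fun i : ↥T => w i) = v)
      = Fintype.piFinset (fun i => if h : i ∈ T then {v ⟨i, h⟩} else Finset.univ) := by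
    ext w
    simp only [Finset.mem_filter, Finset.mem_univ, true_and, Fintype.mem_piFinset, funext_iff]
    refine ⟨fun hw i => ?_, fun hw i => ?_⟩
    · by_cases hi : i ∈ T
      · simpa [hi] using hw ⟨i, hi⟩
      · simp [hi]
    · simpa using hw i
  have h' : ∀ i, (if h : i ∈ T then {v ⟨i, h⟩} else (Finset.univ : Finset G)).card
      = if i ∈ T then 1 else Fintype.card G := fun i => by split_ifs <;> simp
  rw [h, Fintype.card_piFinset, Finset.prod_congr rfl fun i _ => h' i, Finset.prod_ite]
  simp [Finset.filter_not, Finset.card_sdiff]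

/-- Marginal of a uniform library independent of `Q`. -/
theorem pr_prod_restrict (W : Fin K → Ω → (Fin L → F)) (Q : Ω → Θ) (hF : 0 < Fintype.card F)
    (hUnif : ∀ (w : Fin K → Fin L → F) (q : Θ), pr p (fun ω => ((fun i => W i ω), Q ω)) (w, q)
      = ((Fintype.card F : ℝ) ^ (K * L))⁻¹ * pr p Q q)
    (T : Finset (Fin K)) (q : Θ) (v : ↥T → Fin L → F) :
    pr p (fun ω => (Q ω, (fun i : ↥T => W i ω))) (q, v)
      = ((Fintype.card F : ℝ) ^ (T.card * L))⁻¹ * pr p Q q := by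
  have h : pr p (fun ω => (Q ω, (fun i : ↥T => W i ω))) (q, v)
      = ∑ w ∈ (Finset.univ : Finset (Fin K → Fin L → F)).filter
          (fun w => (fun i : ↥T => w i) = v), pr p (fun ω => ((fun i => W i ω), Q ω)) (w, q) := by
    rw [pr, ← Finset.sum_fiberwise_of_maps_to (g := fun ω i => W i ω)
      (t := (Finset.univ : Finset (Fin K → Fin L → F)).filter (fun w => (fun i : ↥T => w i) = v))]
    · refine Finset.sum_congr rfl fun w hw => ?_
      rw [pr, Finset.filter_filter]
      refine Finset.sum_congr ?_ fun _ _ => rfl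
      ext ω
      simp only [Finset.mem_filter, Finset.mem_univ, true_and, Prod.mk.injEq] at hw ⊢
      refine ⟨fun h => ⟨h.2, h.1.1⟩, fun h => ⟨⟨h.2, ?_⟩, h.1⟩⟩
      rw [← hw, ← h.1]
    · intro ω hω
      simp only [Finset.mem_filter, Finset.mem_univ, true_and, Prod.mk.injEq] at hω ⊢
      exact hω.2
  have hT : T.card ≤ K := by simpa using T.card_le_univ
  have hc : (Fintype.card F : ℝ) ≠ 0 := by positivity
  rw [h, Finset.sum_congr rfl fun w _ => hUnif w q, Finset.sum_const, card_filter_restrict_eq,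
    nsmul_eq_mul, ← mul_assoc]
  congr 1
  rw [Fintype.card_fun, Fintype.card_fin]
  push_cast
  rw [← pow_mul, ← div_eq_mul_inv, div_eq_iff (by positivity), inv_mul_eq_div,
    eq_div_iff (by positivity), ← pow_add]
  congr 1
  rw [mul_comm L, ← add_mul, Nat.sub_add_cancel hT]

/-- The files indexed by `T` contribute `|T| * L` to the entropy, independently of `Q`. -/
theorem ent_prod_restrict [Fintype Θ] (hp0 : ∀ ω, 0 ≤ p ω) (hp1 : ∑ ω, p ω = 1)
    (W : Fin K → Ω → (Fin L → F)) (Q : Ω → Θ) (hF : 1 < Fintype.card F)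
    (hUnif : ∀ (w : Fin K → Fin L → F) (q : Θ), pr p (fun ω => ((fun i => W i ω), Q ω)) (w, q)
      = ((Fintype.card F : ℝ) ^ (K * L))⁻¹ * pr p Q q)
    (T : Finset (Fin K)) :
    ent (Fintype.card F) p (fun ω => (Q ω, (fun i : ↥T => W i ω)))
      = T.card * L + ent (Fintype.card F) p Q := by
  have hc : (1 : ℝ) < Fintype.card F := by exact_mod_cast hF
  have hterm : ∀ ω, p ω * Real.logb (Fintype.card F)
      (pr p (fun ω => (Q ω, (fun i : ↥T => W i ω))) (Q ω, (fun i : ↥T => W i ω)))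
      = p ω * Real.logb (Fintype.card F) (pr p Q (Q ω)) - p ω * (T.card * L) := fun ω => by
    rcases (hp0 ω).eq_or_lt with h0 | h0
    · simp [← h0]
    have hq : pr p Q (Q ω) ≠ 0 := (h0.trans_le (le_pr_apply hp0 Q ω)).ne'
    rw [pr_prod_restrict W Q (by omega) hUnif, Real.logb_mul (by positivity) hq, Real.logb_inv,
      Real.logb_pow, Real.logb_self_eq_one hc]
    push_cast
    ring
  rw [ent_eq_neg_sum, ent_eq_neg_sum, Finset.sum_congr rfl fun ω _ => hterm ω,
    Finset.sum_sub_distrib, ← Finset.sum_mul, hp1]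
  ring

end Library

theorem card_filter_fin_Ico {K a c : ℕ} (hc : c ≤ K) :
    ((Finset.univ : Finset (Fin K)).filter (fun i => a ≤ i.val ∧ i.val < c)).card = c - a := by
  rw [← Nat.card_Ico, ← Finset.card_map Fin.valEmbedding]
  congr 1
  ext x
  simp only [Finset.mem_map, Finset.mem_filter, Finset.mem_univ, true_and, Finset.mem_Ico,
    Fin.valEmbedding_apply]
  exact ⟨fun ⟨i, hi, hx⟩ => hx ▸ hi, fun hx => ⟨⟨x, by omega⟩, hx, rfl⟩⟩

theorem geom_lower_bound {N c : ℝ} (hN : 0 < N) (h : ℕ → ℝ) (t : ℕ)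
    (hstep : ∀ j < t, c + h (j + 1) ≤ N * h j) :
    c * ∑ j ∈ Finset.range t, (1 / N) ^ j + N * h t / N ^ t ≤ N * h 0 := by
  induction t with
  | zero => simp
  | succ t ih =>
    refine le_trans ?_ (ih fun j hj => hstep j (by omega))
    have h1 := div_le_div_of_nonneg_right (hstep t (by omega)) (pow_pos hN t).le
    have h2 : N * h (t + 1) / N ^ (t + 1) = h (t + 1) / N ^ t := by
      rw [pow_succ', mul_div_mul_left _ _ hN.ne']
    rw [Finset.sum_range_succ, mul_add, h2, one_div_pow, mul_one_div]
    rw [add_div] at h1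
    linarith

/-- Theorem 1 of the paper, converse part for the regime `P ≤ (K-M)/2`: with
`t = ⌊(K-M)/P⌋`,
`(1/(P·L))·∑ₙ H(Aₙ^{S,𝒫}) ≥ (1-(1/N)^t)/(1-1/N) + ((K-M)/P - t)/N^t`;
moreover if `P ∣ K-M` this bound equals `(1-(1/N)^t)/(1-1/N) = ∑_{j<t} (1/N)^j`. -/
theorem theorem1_converse_low_P
    (F : Type) [Field F] [Fintype F] [DecidableEq F]
    (QT AT : Type) [Fintype QT] [DecidableEq QT] [Fintype AT] [DecidableEq AT]
    (Ω : Type) [Fintype Ω]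
    (p : Ω → ℝ) (hp0 : ∀ ω, 0 ≤ p ω) (hp1 : ∑ ω, p ω = 1)
    (N K L M P : ℕ) (hN : 0 < N) (hMPK : M + P ≤ K)
    (W : Fin K → Ω → (Fin L → F))
    (Qu : ↥(demands K M P) → Fin N → Ω → QT)
    (A : ↥(demands K M P) → Fin N → Ω → AT)
    (Qall : Ω → (↥(demands K M P) → Fin N → QT))
    (hQall : Qall = fun ω d n => Qu d n ω)
    (S : Finset (Fin K)) (hS : S = Finset.univ.filter (fun i => i.val < M))
    (Pd : Finset (Fin K))
    (hPdDef : Pd = Finset.univ.filter (fun i => M ≤ i.val ∧ i.val < M + P))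
    (hPd : Pd ∈ demands K M P)
    -- the files are i.i.d. uniform on `F^L` and independent of all the queries
    (hUnif : ∀ (w : Fin K → Fin L → F) (q : ↥(demands K M P) → Fin N → QT),
      pr p (fun ω => ((fun i => W i ω), Qall ω)) (w, q)
        = ((Fintype.card F : ℝ) ^ (K * L))⁻¹ * pr p Qall q)
    -- each answer is a deterministic function of the library and the received query
    (hAns : ∀ (d : ↥(demands K M P)) (n : Fin N),
      detFn (A d n) (fun ω => ((fun i => W i ω), Qu d n ω)))
    -- decodability
    (hDec : ∀ d : ↥(demands K M P),
      detFn (fun ω => (fun i : ↥(d : Finset (Fin K)) => W i.val ω))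
        (fun ω => ((fun n => A d n ω), Qall ω, (fun i : ↥S => W i.val ω))))
    -- privacy/symmetry (i)
    (hSym : ∀ (n : Fin N) (d d' : ↥(demands K M P)) (T : Finset (Fin K)),
      condEnt (Fintype.card F) p (A d n)
          (fun ω => (Qall ω, (fun i : ↥T => W i.val ω)))
        = condEnt (Fintype.card F) p (A d' ⟨0, hN⟩)
          (fun ω => (Qall ω, (fun i : ↥T => W i.val ω))))
    -- privacy/symmetry (ii)
    (hMix : ∀ (n : Fin N) (d d' : ↥(demands K M P)),
      detFn (fun ω => (fun i : ↥(d : Finset (Fin K)) => W i.val ω))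
        (fun ω => ((fun m : Fin N => if m = n then A d' n ω else A d m ω),
          Qall ω, (fun i : ↥S => W i.val ω))))
    (hP : 0 < P) (hL : 0 < L) (hN2 : 2 ≤ N)
    (hReg : (P : ℝ) ≤ ((K : ℝ) - M) / 2) :
    ((1 - (1 / (N : ℝ)) ^ ((K - M) / P)) / (1 - 1 / (N : ℝ))
        + (((K : ℝ) - M) / P - (((K - M) / P : ℕ) : ℝ)) / (N : ℝ) ^ ((K - M) / P)
      ≤ (1 / ((P : ℝ) * L)) * ∑ n : Fin N, ent (Fintype.card F) p (A ⟨Pd, hPd⟩ n))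
    ∧ (P ∣ (K - M) →
        (1 - (1 / (N : ℝ)) ^ ((K - M) / P)) / (1 - 1 / (N : ℝ))
            + (((K : ℝ) - M) / P - (((K - M) / P : ℕ) : ℝ)) / (N : ℝ) ^ ((K - M) / P)
          = (1 - (1 / (N : ℝ)) ^ ((K - M) / P)) / (1 - 1 / (N : ℝ))
        ∧ (1 - (1 / (N : ℝ)) ^ ((K - M) / P)) / (1 - 1 / (N : ℝ))
          = ∑ j ∈ Finset.range ((K - M) / P), (1 / (N : ℝ)) ^ j) := by
  have hF : 1 < Fintype.card F := Fintype.one_lt_card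
  have hb : (1 : ℝ) < Fintype.card F := by exact_mod_cast hF
  have hNpos : (0 : ℝ) < N := by exact_mod_cast hN
  have hN1 : (1 : ℝ) < N := by exact_mod_cast hN2
  have hPR : (0 : ℝ) < P := by exact_mod_cast hP
  have hLR : (0 : ℝ) < L := by exact_mod_cast hL
  have hKM : ((K - M : ℕ) : ℝ) = (K : ℝ) - M := Nat.cast_sub (by omega)
  have hgeom : (1 - (1 / (N : ℝ)) ^ ((K - M) / P)) / (1 - 1 / (N : ℝ))
      = ∑ j ∈ Finset.range ((K - M) / P), (1 / (N : ℝ)) ^ j := by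
    have h1 : 1 / (N : ℝ) < 1 := by rwa [div_lt_one hNpos]
    rw [geom_sum_eq h1.ne, ← neg_div_neg_eq, neg_sub, neg_sub]
  have hrem : ((K : ℝ) - M) / P - (((K - M) / P : ℕ) : ℝ) = ((K - M) % P : ℕ) / (P : ℝ) := by
    have h := congrArg (Nat.cast (R := ℝ)) (Nat.div_add_mod (K - M) P)
    push_cast at h
    rw [← hKM, eq_div_iff hPR.ne', sub_mul, div_mul_cancel₀ _ hPR.ne']
    linarith
  refine ⟨?_, fun hdvd => ⟨?_, hgeom⟩⟩
  swap
  · rw [hrem, Nat.mod_eq_zero_of_dvd hdvd]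
    simp
  rw [hgeom, hrem]
  set t := (K - M) / P with ht
  set r := (K - M) % P with hr
  have hdiv : P * t + r = K - M := Nat.div_add_mod _ _
  let d₀ : ↥(demands K M P) := ⟨Pd, hPd⟩
  let T : ℕ → Finset (Fin K) := fun a => Finset.univ.filter fun i => i.val < a
  let Y : (V : Finset (Fin K)) → Ω → (↥(demands K M P) → Fin N → QT) × (↥V → Fin L → F) :=
    fun V ω => (Qall ω, fun i : ↥V => W i.val ω)
  let h : ℕ → ℝ := fun a => condEnt (Fintype.card F) p (A d₀ ⟨0, hN⟩) (Y (T a))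
  have hcardT : ∀ a ≤ K, (T a).card = a := fun a ha => by
    simpa [T] using card_filter_fin_Ico (a := 0) ha
  have hent : ∀ a ≤ K, ent (Fintype.card F) p (Y (T a))
      = a * L + ent (Fintype.card F) p Qall := fun a ha => by
    have := ent_prod_restrict hp0 hp1 W Qall hF hUnif (T a)
    rwa [hcardT a ha] at this
  -- learning the demand `{c - P, …, c - 1}` when the files below `a` are known
  have step : ∀ a c, M ≤ a → a ≤ c → c ≤ K → M + P ≤ c → c ≤ a + P →
      ((c : ℝ) - a) * L + h c ≤ N * h a := by
    intro a c hMa hac hcK hPc hca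
    let D : Finset (Fin K) := Finset.univ.filter fun i => c - P ≤ i.val ∧ i.val < c
    have hD : D ∈ demands K M P := by
      simp only [demands, Finset.mem_filter, Finset.mem_univ, true_and]
      refine ⟨(card_filter_fin_Ico hcK).trans (by omega), fun i hi => ?_⟩
      have := (Finset.mem_filter.1 hi).2
      omega
    obtain ⟨f, hf⟩ := hDec ⟨D, hD⟩
    have hdet : detFn (Y (T c)) (fun ω => ((fun n => A ⟨D, hD⟩ n ω), Y (T a) ω)) := by
      have hSa : ∀ i : ↥S, i.val ∈ T a := fun i => by
        have := (Finset.mem_filter.1 (hS.le i.2)).2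
        simp only [T, Finset.mem_filter, Finset.mem_univ, true_and]
        omega
      have hmem : ∀ i : ↥(T c), i.val ∉ T a → i.val ∈ D := fun i hi => by
        have hi' := i.2
        simp only [T, D, Finset.mem_filter, Finset.mem_univ, true_and] at hi hi' ⊢
        omega
      refine ⟨fun u => (u.2.1, fun i => if hi : i.val ∈ T a then u.2.2 ⟨i.val, hi⟩
        else f (u.1, u.2.1, fun j => u.2.2 ⟨j.val, hSa j⟩) ⟨i.val, hmem i hi⟩),
        fun ω => Prod.ext rfl (funext fun i => ?_)⟩
      by_cases hi : i.val ∈ T a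
      · simp [Y, hi]
      · have := congrFun (hf ω) ⟨i.val, hmem i hi⟩
        simpa [Y, hi] using this
    have key := ent_sub_add_condEnt_le_sum hb hp0 (A ⟨D, hD⟩) (Y (T a)) (Y (T c)) ⟨0, hN⟩ hdet
    rw [hent a (by omega), hent c hcK, Finset.sum_congr rfl fun n _ => hSym n ⟨D, hD⟩ d₀ (T a),
      hSym ⟨0, hN⟩ ⟨D, hD⟩ d₀ (T c), Finset.sum_const, Finset.card_univ, Fintype.card_fin,
      nsmul_eq_mul] at key
    change _ + h c ≤ N * h a at key
    linarith
  have hbound := geom_lower_bound (c := P * L) hNpos (fun j => h (M + P * j)) t fun j hj => by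
    have h1 : P * (j + 1) ≤ P * t := Nat.mul_le_mul_left P hj
    have h2 : P * (j + 1) = P * j + P := by ring
    have := step (M + P * j) (M + P * (j + 1)) (by omega) (by omega) (by omega) (by omega)
      (by omega)
    push_cast at this ⊢
    linarith
  have hlast : (r : ℝ) * L ≤ N * h (M + P * t) := by
    have hr' : r < P := Nat.mod_lt _ hP
    have h1 := step (M + P * t) K (by omega) (by omega) le_rfl hMPK (by omega)
    have h2 : (K : ℝ) = M + P * t + r := by
      have : K = M + P * t + r := by omega
      exact_mod_cast this
    have h3 : 0 ≤ h K := condEnt_nonneg hb hp0 _ _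
    push_cast at h1
    rw [h2] at h1
    linarith
  have hsum : N * h M ≤ ∑ n : Fin N, ent (Fintype.card F) p (A d₀ n) := by
    have h1 : ∀ n, h M ≤ ent (Fintype.card F) p (A d₀ n) := fun n =>
      (hSym n d₀ d₀ (T M)).symm.le.trans (condEnt_le_ent hb hp0 hp1 _ _)
    simpa using Finset.sum_le_sum fun n (_ : n ∈ Finset.univ) => h1 n
  have hlast' := div_le_div_of_nonneg_right hlast (pow_pos hNpos t).le
  simp only [mul_zero, add_zero] at hbound
  rw [one_div_mul_eq_div, le_div_iff₀ (by positivity)]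
  calc _ = P * L * ∑ j ∈ Finset.range t, (1 / (N : ℝ)) ^ j + r * L / (N : ℝ) ^ t := by
        field_simp
    _ ≤ _ := by
        have := hbound.trans hsum
        linarith
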